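/- arXiv:1612.08158 — 2 statements merged into one kernel-verified Lean document; each statement's English description precedes it below -/
import Mathlib

section
/- Let p be a prime with p > n + 1, and let k and l be integers with 1 ≤ l < k ≤ n such that p divides k^3 + 1 and p divides l^3 + 1. Then k + l − 1 = p. -/
/-- If a prime `p` divides `m ^ 3 + 1` with `m + 1 < p`, then it divides the cofactor
`m ^ 2 - m + 1` of `m + 1`. -/
theorem Nat.Prime.dvd_sq_sub_add_one_of_dvd_cube_add_one {p m : ℕ} (hp : p.Prime)
    (hm : m + 1 < p) (h : p ∣ m ^ 3 + 1) : (p : ℤ) ∣ (m : ℤ) ^ 2 - m + 1 := by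
  have hmul : (p : ℤ) ∣ ((m + 1 : ℕ) : ℤ) * ((m : ℤ) ^ 2 - m + 1) := by
    have h' : (p : ℤ) ∣ ((m ^ 3 + 1 : ℕ) : ℤ) := Int.natCast_dvd_natCast.mpr h
    convert h' using 1
    push_cast
    ring
  refine ((Nat.prime_iff_prime_int.mp hp).dvd_or_dvd hmul).resolve_left fun hd => ?_
  exact Nat.not_dvd_of_pos_of_lt m.succ_pos hm (Int.natCast_dvd_natCast.mp hd)

theorem k_add_l_sub_one_eq_p (n p k l : ℕ) (hp : p.Prime) (hpn : p > n + 1)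
    (hl : 1 ≤ l) (hlk : l < k) (hkn : k ≤ n)
    (hk : p ∣ k ^ 3 + 1) (hl' : p ∣ l ^ 3 + 1) : k + l - 1 = p := by
  have hk2 := hp.dvd_sq_sub_add_one_of_dvd_cube_add_one (by omega) hk
  have hl2 := hp.dvd_sq_sub_add_one_of_dvd_cube_add_one (by omega) hl'
  have hmul : (p : ℤ) ∣ ((k - l : ℕ) : ℤ) * ((k + l - 1 : ℕ) : ℤ) := by
    have hfactor : ((k - l : ℕ) : ℤ) * ((k + l - 1 : ℕ) : ℤ) =
        ((k : ℤ) ^ 2 - k + 1) - ((l : ℤ) ^ 2 - l + 1) := by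
      rw [Nat.cast_sub hlk.le, Nat.cast_sub (by omega)]
      push_cast
      ring
    exact hfactor ▸ dvd_sub hk2 hl2
  have hsum : p ∣ k + l - 1 :=
    (hp.dvd_mul.mp (by exact_mod_cast hmul)).resolve_left
      (Nat.not_dvd_of_pos_of_lt (by omega) (by omega))
  exact Nat.eq_of_dvd_of_lt_two_mul (by omega) hsum (by omega)
end

section
/- For every real number x > 10000, π(x) < 1.139·x / log x. -/
def sievingPrimes : List ℕ :=
  [2, 3, 5, 7, 11, 13, 17, 19, 23, 29, 31, 37, 41, 43, 47, 53, 59, 61, 67, 71, 73, 79, 83, 89,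
   97, 101, 103, 107, 109, 113, 127, 131, 137, 139, 149, 151, 157, 163, 167, 173, 179, 181,
   191, 193, 197, 199, 211, 223, 227, 229, 233, 239, 241, 251, 257, 263, 269, 271, 277, 281,
   283, 293, 307, 311, 313, 317, 331, 337, 347, 349, 353, 359, 367, 373, 379, 383, 389, 397,
   401, 409, 419, 421, 431, 433, 439, 443, 449, 457, 461, 463, 467, 479, 487, 491, 499, 503,
   509, 521, 523, 541, 547, 557, 563, 569, 571, 577, 587, 593, 599, 601, 607, 613, 617, 619,
   631, 641, 643, 647, 653, 659, 661, 673, 677, 683, 691, 701, 709, 719, 727, 733, 739, 743,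
   751, 757, 761, 769, 773, 787, 797, 809, 811, 821, 823, 827, 829, 839, 853, 857, 859, 863,
   877, 881, 883, 887, 907, 911, 919, 929, 937, 941, 947, 953, 967, 971, 977, 983, 991, 997,
   1009, 1013, 1019, 1021, 1031, 1033, 1039, 1049, 1051, 1061, 1063, 1069, 1087, 1091, 1093,
   1097, 1103, 1109, 1117, 1123, 1129, 1151, 1153, 1163, 1171, 1181, 1187, 1193, 1201, 1213,
   1217, 1223, 1229, 1231, 1237, 1249, 1259, 1277, 1279, 1283, 1289, 1291, 1297, 1301, 1303,
   1307, 1319, 1321, 1327, 1361, 1367, 1373, 1381, 1399, 1409, 1423, 1427, 1429, 1433, 1439,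
   1447, 1451, 1453, 1459, 1471, 1481, 1483, 1487, 1489, 1493, 1499, 1511, 1523, 1531, 1543,
   1549, 1553, 1559, 1567, 1571, 1579, 1583, 1597, 1601, 1607, 1609, 1613, 1619, 1621, 1627,
   1637, 1657, 1663, 1667, 1669, 1693, 1697, 1699, 1709, 1721, 1723, 1733, 1741, 1747, 1753,
   1759, 1777, 1783, 1787, 1789, 1801, 1811, 1823, 1831, 1847, 1861, 1867, 1871, 1873, 1877,
   1879, 1889, 1901, 1907, 1913, 1931, 1933, 1949, 1951, 1973, 1979, 1987, 1993, 1997, 1999,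
   2003, 2011, 2017, 2027, 2029, 2039, 2053, 2063, 2069, 2081, 2083, 2087, 2089, 2099, 2111,
   2113, 2129, 2131, 2137, 2141, 2143, 2153, 2161, 2179, 2203, 2207, 2213, 2221, 2237, 2239,
   2243, 2251, 2267, 2269, 2273, 2281, 2287, 2293, 2297, 2309, 2311, 2333, 2339, 2341, 2347,
   2351, 2357, 2371, 2377, 2381, 2383, 2389, 2393, 2399, 2411, 2417, 2423, 2437, 2441, 2447,
   2459, 2467, 2473, 2477, 2503, 2521, 2531, 2539, 2543, 2549, 2551, 2557, 2579, 2591, 2593,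
   2609, 2617, 2621, 2633, 2647, 2657, 2659, 2663, 2671, 2677, 2683, 2687, 2689, 2693, 2699,
   2707, 2711, 2713, 2719, 2729, 2731, 2741, 2749, 2753, 2767, 2777, 2789, 2791, 2797, 2801,
   2803, 2819, 2833, 2837, 2843, 2851, 2857, 2861, 2879, 2887, 2897, 2903, 2909, 2917, 2927,
   2939, 2953, 2957, 2963, 2969, 2971, 2999, 3001, 3011, 3019, 3023, 3037, 3041, 3049, 3061,
   3067, 3079, 3083, 3089, 3109, 3119, 3121, 3137, 3163, 3167, 3169, 3181, 3187, 3191, 3203,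
   3209, 3217, 3221, 3229, 3251, 3253, 3257, 3259, 3271, 3299, 3301, 3307, 3313, 3319, 3323,
   3329, 3331, 3343, 3347, 3359, 3361, 3371, 3373, 3389, 3391, 3407, 3413, 3433, 3449, 3457,
   3461, 3463, 3467, 3469, 3491, 3499, 3511, 3517, 3527, 3529, 3533, 3539, 3541, 3547, 3557,
   3559, 3571, 3581, 3583, 3593]

/-- The bits `i ≤ m` of this number are those with `p ∣ a + i`. -/
def multiplesMask (a m p : ℕ) : ℕ :=
  ((2 ^ (p * (m / p + 1)) - 1) / (2 ^ p - 1)) <<< (p * ((a + p - 1) / p) - a)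

def compositeMask (a m : ℕ) : List ℕ → ℕ
  | [] => 0
  | p :: ps => bif Nat.ble (p * p) (a + m) then multiplesMask a m p ||| compositeMask a m ps else 0

/-- `f n`, arranged so that the kernel evaluates `n` before it substitutes it into `f`. -/
def withValue {α : Type} (n : ℕ) (f : ℕ → α) : α :=
  match n with
  | 0 => f 0
  | k + 1 => f (k + 1)

/-- The number of bits of `W` at positions in the residue classes `0, …, n - 1` modulo `24`. -/
def bitCountAux (W M : ℕ) : ℕ → ℕ
  | 0 => 0
  | j + 1 => ((W >>> j) &&& M) % (2 ^ 24 - 1) + bitCountAux W M j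

def bitCount (m W : ℕ) : ℕ :=
  withValue (W % 2 ^ m) fun W ↦
    withValue ((2 ^ (24 * (m / 24 + 1)) - 1) / (2 ^ 24 - 1)) fun M ↦ bitCountAux W M 24

def sieveBound (a m : ℕ) : ℕ := m - bitCount m (compositeMask a m sievingPrimes)

def checkFrom (T : ℕ) : ℕ → ℕ → ℕ → ℕ → Bool
  | 0, _, _, _ => false
  | k + 1, a, B, L =>
    bif Nat.ble T a then true else
      withValue ((1139 * a * 1000 / L - B) * L * 8 / 10000000) fun m ↦
      withValue (a + m) fun a' ↦
      withValue (B + sieveBound a m) fun B' ↦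
      withValue (L + (a' * a' - a * a) * 1000000 / (2 * a * a') + 1) fun L' ↦
        Nat.blt (1000 * B' * L) (1139 * a * 1000000) && checkFrom T k a' B' L'

theorem withValue_eq {α : Type} (n : ℕ) (f : ℕ → α) : withValue n f = f n := by
  cases n <;> rfl

theorem dvd_of_testBit_repunit {p k i : ℕ} (hp : 2 ≤ p)
    (h : ((2 ^ (p * k) - 1) / (2 ^ p - 1)).testBit i = true) : p ∣ i := by
  have h2 : 2 ≤ 2 ^ p := by
    calc 2 = 2 ^ 1 := rfl
      _ ≤ 2 ^ p := Nat.pow_le_pow_right (by norm_num) (by omega)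
  rw [pow_mul, ← Nat.geomSum_eq h2] at h
  induction k with
  | zero => simp at h
  | succ k ih =>
    rw [Finset.sum_range_succ, ← pow_mul, add_comm] at h
    have hlt : ∑ j ∈ Finset.range k, (2 ^ p) ^ j < 2 ^ (p * k) := by
      rw [Nat.geomSum_eq h2, pow_mul]
      have : 0 < (2 ^ p) ^ k := by positivity
      exact (Nat.div_le_self _ _).trans_lt (by omega)
    rw [← mul_one (2 ^ (p * k)), Nat.testBit_two_pow_mul_add _ hlt] at h
    split_ifs at h with hi
    · exact ih h
    · rw [Nat.testBit_one_eq_true_iff_self_eq_zero] at h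
      have : i = p * k := by omega
      exact ⟨k, this⟩

theorem dvd_of_testBit_multiplesMask {a m p i : ℕ} (hp : 2 ≤ p)
    (h : (multiplesMask a m p).testBit i = true) : p ∣ a + i := by
  rw [multiplesMask, Nat.testBit_shiftLeft] at h
  simp only [Bool.and_eq_true, decide_eq_true_eq] at h
  obtain ⟨hs, h⟩ := h
  have hd := dvd_of_testBit_repunit hp h
  have hle : a ≤ p * ((a + p - 1) / p) := by
    have h1 := Nat.div_add_mod (a + p - 1) p
    have h2 := Nat.mod_lt (a + p - 1) (show 0 < p by omega)
    omega
  have : a + i = p * ((a + p - 1) / p) + (i - (p * ((a + p - 1) / p) - a)) := by omega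
  rw [this]
  exact (Nat.dvd_mul_right _ _).add hd

theorem not_prime_of_testBit_compositeMask {a m i : ℕ} {l : List ℕ}
    (hl : ∀ p ∈ l, 2 ≤ p ∧ (p * p ≤ a + m → p < a))
    (h : (compositeMask a m l).testBit i = true) :
    ¬ (a + i).Prime := by
  induction l with
  | nil => simp [compositeMask] at h
  | cons p ps ih =>
    obtain ⟨⟨hp, hpa⟩, hps⟩ := List.forall_mem_cons.1 hl
    rw [compositeMask] at h
    cases hb : Nat.ble (p * p) (a + m) with
    | false => simp [hb] at h
    | true =>
      rw [hb, cond_true, Nat.testBit_or, Bool.or_eq_true] at h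
      rcases h with h | h
      · have := hpa (Nat.le_of_ble_eq_true hb)
        exact Nat.not_prime_of_dvd_of_lt (dvd_of_testBit_multiplesMask hp h) hp (by omega)
      · exact ih hps h

theorem mod_le_card_bitIndices {X k : ℕ} (hX : ∀ i, X.testBit i = true → k ∣ i) :
    X % (2 ^ k - 1) ≤ X.bitIndices.toFinset.card := by
  have h : X ≡ X.bitIndices.toFinset.card [MOD 2 ^ k - 1] := by
    conv_lhs => rw [← Finset.sum_toFinset_bitIndices_two_pow X]
    rw [Finset.card_eq_sum_ones]
    refine Nat.ModEq.sum fun i hi ↦ ?_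
    obtain ⟨j, rfl⟩ := hX i (by simpa using hi)
    have h1 : 2 ^ k ≡ 1 [MOD 2 ^ k - 1] := by
      have := Nat.one_le_two_pow (n := k)
      exact ((Nat.modEq_iff_dvd' this).2 dvd_rfl).symm
    simpa [pow_mul] using h1.pow j
  rw [h]
  exact Nat.mod_le _ _

theorem bitCountAux_le {m W k : ℕ} (n : ℕ) (hn : n ≤ 24) :
    bitCountAux (W % 2 ^ m) ((2 ^ (24 * k) - 1) / (2 ^ 24 - 1)) n ≤
      ((Finset.range m).filter fun i ↦ W.testBit i = true ∧ i % 24 < n).card := by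
  set M := (2 ^ (24 * k) - 1) / (2 ^ 24 - 1)
  induction n with
  | zero => simp [bitCountAux]
  | succ n ih =>
    have hsplit : ((Finset.range m).filter fun i ↦ W.testBit i = true ∧ i % 24 < n + 1) =
        ((Finset.range m).filter fun i ↦ W.testBit i = true ∧ i % 24 = n) ∪
        ((Finset.range m).filter fun i ↦ W.testBit i = true ∧ i % 24 < n) := by
      ext i
      simp only [Finset.mem_filter, Finset.mem_union, Finset.mem_range]
      constructor
      · rintro ⟨h1, h2, h3⟩
        rcases Nat.lt_succ_iff_lt_or_eq.1 h3 with h | h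
        · exact Or.inr ⟨h1, h2, h⟩
        · exact Or.inl ⟨h1, h2, h⟩
      · rintro (⟨h1, h2, h3⟩ | ⟨h1, h2, h3⟩)
        · exact ⟨h1, h2, by omega⟩
        · exact ⟨h1, h2, by omega⟩
    rw [bitCountAux, hsplit, Finset.card_union_of_disjoint]
    · refine add_le_add ?_ (ih (by omega))
      have hbit : ∀ i, (((W % 2 ^ m) >>> n) &&& M).testBit i = true →
          (n + i < m ∧ W.testBit (n + i) = true) ∧ 24 ∣ i := by
        intro i hi
        rw [Nat.testBit_and, Nat.testBit_shiftRight, Nat.testBit_mod_two_pow] at hi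
        simp only [Bool.and_eq_true, decide_eq_true_eq] at hi
        exact ⟨hi.1, dvd_of_testBit_repunit (by norm_num) hi.2⟩
      refine (mod_le_card_bitIndices fun i hi ↦ (hbit i hi).2).trans ?_
      refine Finset.card_le_card_of_injOn (fun i ↦ n + i) (fun i hi ↦ ?_)
        (fun i _ j _ h ↦ by simpa using h)
      have := hbit i (by simpa using hi)
      simp only [Finset.coe_filter, Finset.mem_range, Set.mem_ofPred_eq]
      exact ⟨this.1.1, this.1.2, by omega⟩
    · rw [Finset.disjoint_left]
      intro i hi hj
      simp only [Finset.mem_filter] at hi hj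
      omega

theorem bitCount_le (m W : ℕ) :
    bitCount m W ≤ ((Finset.range m).filter fun i ↦ W.testBit i = true).card := by
  rw [bitCount, withValue_eq, withValue_eq]
  refine (bitCountAux_le 24 le_rfl).trans (Finset.card_le_card fun i hi ↦ ?_)
  simp only [Finset.mem_filter] at hi ⊢
  exact ⟨hi.1, hi.2.1⟩

theorem primeCounting'_add_le {a m : ℕ} (h : 3593 < a ∨ a + m < a * a) :
    Nat.primeCounting' (a + m) ≤ Nat.primeCounting' a + sieveBound a m := by
  have hl : ∀ p ∈ sievingPrimes, 2 ≤ p ∧ (p * p ≤ a + m → p < a) := by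
    have hmem : ∀ p ∈ sievingPrimes, 2 ≤ p ∧ p ≤ 3593 := by decide +kernel
    refine fun p hp ↦ ⟨(hmem p hp).1, fun hpp ↦ ?_⟩
    rcases h with h | h
    · exact (hmem p hp).2.trans_lt h
    · exact lt_of_mul_self_lt_mul_self₀ a.zero_le (hpp.trans_lt h)
  rw [Nat.primeCounting', Nat.count_add, sieveBound]
  refine Nat.add_le_add_left ?_ _
  rw [Nat.count_eq_card_filter_range]
  have h1 := bitCount_le m (compositeMask a m sievingPrimes)
  have h2 : ((Finset.range m).filter fun i ↦ (a + i).Prime).card +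
      ((Finset.range m).filter
        fun i ↦ (compositeMask a m sievingPrimes).testBit i = true).card ≤ m := by
    rw [← Finset.card_union_of_disjoint]
    · conv_rhs => rw [← Finset.card_range m]
      exact Finset.card_le_card
        (Finset.union_subset (Finset.filter_subset _ _) (Finset.filter_subset _ _))
    · rw [Finset.disjoint_left]
      intro i hi hj
      exact not_prime_of_testBit_compositeMask hl (Finset.mem_filter.1 hj).2
        (Finset.mem_filter.1 hi).2
  omega

theorem log_div_le_half_sub {t : ℝ} (ht : 1 ≤ t) : Real.log t ≤ (t - t⁻¹) / 2 := by
  have h := Real.self_le_sinh_iff.2 (Real.log_nonneg ht)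
  rwa [Real.sinh_log (by linarith)] at h

theorem div_log_mono {x y : ℝ} (hx : Real.exp 1 ≤ x) (hxy : x ≤ y) :
    x / Real.log x ≤ y / Real.log y := by
  have h := Real.log_div_self_antitoneOn hx (hx.trans hxy) hxy
  have h1 : 0 < Real.log x := by
    have : 1 < x := lt_of_lt_of_le (by linarith [Real.add_one_le_exp 1]) hx
    exact Real.log_pos this
  have h2 : 0 < Real.log y := by
    have : 1 < y := lt_of_lt_of_le (by linarith [Real.add_one_le_exp 1]) (hx.trans hxy)
    exact Real.log_pos this
  have hx0 : 0 < x := (Real.exp_pos 1).trans_le hx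
  have hy0 : 0 < y := hx0.trans_le hxy
  rw [div_le_div_iff₀ hy0 hx0] at h
  rw [div_le_div_iff₀ h1 h2]
  linarith

theorem primeCounting_lt_of_checkFrom {T : ℕ} (k : ℕ) {a B L : ℕ} (ha : 3593 < a)
    (hB : Nat.primeCounting' a ≤ B) (hL : Real.log a ≤ L / 1000000)
    (h : checkFrom T k a B L = true) {x : ℝ} (hax : a ≤ x) (hxT : x < T) :
    (Nat.primeCounting ⌊x⌋₊ : ℝ) < 1.139 * x / Real.log x := by
  induction k generalizing a B L with
  | zero => simp [checkFrom] at h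
  | succ k ih =>
    rw [checkFrom] at h
    have hTa : Nat.ble T a = false := by
      rw [Bool.eq_false_iff, Ne, Nat.ble_eq, not_le]
      exact_mod_cast hax.trans_lt hxT
    simp only [hTa, cond_false, withValue_eq, Bool.and_eq_true, Nat.blt_eq] at h
    generalize (1139 * a * 1000 / L - B) * L * 8 / 10000000 = m at h
    obtain ⟨h1, h2⟩ := h
    have hB' := (primeCounting'_add_le (m := m) (.inl ha)).trans (Nat.add_le_add_right hB _)
    have ha0 : (3593 : ℝ) < a := by exact_mod_cast ha
    rcases le_or_gt ((a + m : ℕ) : ℝ) x with hx | hx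
    · refine ih (by omega) hB' ?_ h2 hx
      have ha' : (a : ℝ) ≤ (a + m : ℕ) := by exact_mod_cast Nat.le_add_right a m
      have hsq : a * a ≤ (a + m) * (a + m) := Nat.mul_le_mul (by omega) (by omega)
      have hlog : Real.log ((a + m : ℕ) : ℝ) = Real.log a + Real.log ((a + m : ℕ) / a) := by
        rw [Real.log_div (by linarith) (by linarith)]; ring
      have hstep := log_div_le_half_sub ((one_le_div (by linarith)).2 ha' : 1 ≤ ((a + m : ℕ) : ℝ) / a)
      have hfloor : ((((a + m) * (a + m) - a * a) * 1000000 : ℕ) : ℝ) / (2 * a * (a + m) : ℕ) ≤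
          ((((a + m) * (a + m) - a * a) * 1000000 / (2 * a * (a + m)) : ℕ) : ℝ) + 1 :=
        (Nat.lt_floor_add_one (R := ℝ) _).le.trans_eq (by rw [Nat.floor_div_eq_div])
      rw [hlog]
      push_cast [Nat.cast_sub hsq] at hfloor hstep ha' ⊢
      have hcancel : ((a + m : ℝ) / a - ((a + m : ℝ) / a)⁻¹) / 2 =
          (((a + m : ℝ) * (a + m) - a * a) * 1000000 / (2 * a * (a + m))) / 1000000 := by
        have : (a : ℝ) ≠ 0 := by linarith
        have : (a + m : ℝ) ≠ 0 := by linarith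
        field_simp
      rw [hcancel] at hstep
      linarith
    · have hx0 : ⌊x⌋₊ + 1 ≤ a + m := (Nat.floor_lt (by linarith)).2 hx
      have hpi : Nat.primeCounting ⌊x⌋₊ ≤ B + sieveBound a m :=
        (Nat.monotone_primeCounting' hx0).trans hB'
      have hmono := div_log_mono (show Real.exp 1 ≤ (a : ℝ) by
        linarith [Real.exp_one_lt_d9]) hax
      have hloga : 0 < Real.log a := Real.log_pos (by linarith)
      have h1' : (1000 * (B + sieveBound a m : ℕ) * L : ℝ) < 1139 * a * 1000000 := by
        exact_mod_cast h1
      have hpi' : (Nat.primeCounting ⌊x⌋₊ : ℝ) ≤ (B + sieveBound a m : ℕ) := by exact_mod_cast hpi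
      refine hpi'.trans_lt (lt_of_lt_of_le ?_
        ((mul_le_mul_of_nonneg_left hmono (by norm_num : (0 : ℝ) ≤ 1.139)).trans_eq
          (mul_div_assoc _ _ _).symm))
      rw [← mul_div_assoc, lt_div_iff₀ hloga]
      have := mul_le_mul_of_nonneg_left hL (Nat.cast_nonneg (α := ℝ) (B + sieveBound a m))
      linarith

theorem primeCounting'_ten_thousand_le : Nat.primeCounting' 10000 ≤ 1229 := by
  have h := primeCounting'_add_le (a := 101) (m := 9899) (.inr (by norm_num))
  have h1 : Nat.primeCounting' 101 = 25 := by decide +kernel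
  have h2 : sieveBound 101 9899 = 1204 := by decide +kernel
  rwa [h1, h2] at h

theorem primeCounting_lt_of_lt_twelve_million {x : ℝ} (hx : 10000 ≤ x) (hx' : x < 12000000) :
    (Nat.primeCounting ⌊x⌋₊ : ℝ) < 1.139 * x / Real.log x := by
  have hcheck : checkFrom 12000000 300 10000 1229 9210341 = true := by decide +kernel
  refine primeCounting_lt_of_checkFrom 300 (by norm_num) primeCounting'_ten_thousand_le ?_ hcheck
    (by exact_mod_cast hx) (by exact_mod_cast hx')
  have h : ((10000 : ℕ) : ℝ) = (2 * 5) ^ 4 := by norm_num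
  rw [h, Real.log_pow, Real.log_mul (by norm_num) (by norm_num)]
  push_cast
  linarith [Real.log_two_lt_d9, Real.log_five_lt_d9]

theorem log_factorial_eq_sum_vonMangoldt (N : ℕ) :
    Real.log (N.factorial : ℝ) =
      ∑ n ∈ Finset.Ioc 0 N, ArithmeticFunction.vonMangoldt n * ((N / n : ℕ) : ℝ) := by
  rw [← ArithmeticFunction.sum_Ioc_mul_zeta_eq_sum, ArithmeticFunction.vonMangoldt_mul_zeta]
  induction N with
  | zero => simp
  | succ N ih =>
    rw [← Finset.insert_Ioc_right_eq_Ioc_add_one (by omega), Finset.sum_insert (by simp), ← ih,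
      Nat.factorial_succ, Nat.cast_mul, Real.log_mul (by positivity) (by positivity)]
    simp

theorem log_factorial_div_eq_sum_vonMangoldt (N : ℕ) (d : ℕ) :
    Real.log ((N / d).factorial : ℝ) =
      ∑ n ∈ Finset.Ioc 0 N, ArithmeticFunction.vonMangoldt n * ((N / n / d : ℕ) : ℝ) := by
  rw [log_factorial_eq_sum_vonMangoldt]
  refine Finset.sum_subset_zero_on_sdiff (Finset.Ioc_subset_Ioc_right (Nat.div_le_self _ _))
    (fun n hn ↦ ?_) fun n _ ↦ ?_
  · simp only [Finset.mem_sdiff, Finset.mem_Ioc, not_and, not_le] at hn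
    rw [Nat.div_div_eq_div_mul, mul_comm n d, ← Nat.div_div_eq_div_mul,
      Nat.div_eq_of_lt (hn.2 hn.1.1), Nat.cast_zero, mul_zero]
  · rw [Nat.div_div_eq_div_mul, Nat.div_div_eq_div_mul, mul_comm d n]

theorem mul_log_sub_self_mono {x y : ℝ} (hx : 1 ≤ x) (hxy : x ≤ y) :
    x * Real.log x - x ≤ y * Real.log y - y := by
  have h := Real.one_sub_inv_le_log_of_pos (show 0 < y / x from div_pos (by linarith) (by linarith))
  have hy : y ≠ 0 := by linarith
  rw [Real.log_div (by linarith) (by linarith), inv_div] at h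
  have h1 : y * (1 - x / y) = y - x := by field_simp
  have h2 := mul_le_mul_of_nonneg_left h (show 0 ≤ y by linarith)
  have h3 := mul_le_mul_of_nonneg_right hxy (Real.log_nonneg hx)
  rw [h1] at h2
  linarith

theorem log_factorial_le (n : ℕ) (hn : 1 ≤ n) :
    Real.log (n.factorial : ℝ) ≤ n * Real.log n - n + 1 + Real.log n := by
  induction n, hn using Nat.le_induction with
  | base => simp
  | succ n hn ih =>
    have hn0 : (0 : ℝ) < n := by exact_mod_cast hn
    rw [Nat.factorial_succ, Nat.cast_mul, Real.log_mul (by positivity) (by positivity)]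
    have h := Real.one_sub_inv_le_log_of_pos (show 0 < ((n + 1 : ℕ) : ℝ) / n by positivity)
    rw [Real.log_div (by positivity) (by positivity), inv_div] at h
    have h1 : ((n + 1 : ℕ) : ℝ) * (1 - n / (n + 1 : ℕ)) = 1 := by
      push_cast; field_simp; ring
    have h2 := mul_le_mul_of_nonneg_left h (Nat.cast_nonneg (α := ℝ) (n + 1))
    rw [h1] at h2
    push_cast at h2 ⊢
    linarith

theorem mul_log_sub_le_log_factorial (n : ℕ) :
    n * Real.log n - n ≤ Real.log (n.factorial : ℝ) := by
  rcases n.eq_zero_or_pos with rfl | hn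
  · simp
  have hn0 : (0 : ℝ) < n := by exact_mod_cast hn
  have h := Real.log_le_log (by positivity) (Real.pow_div_factorial_le_exp (n : ℝ) hn0.le n)
  rw [Real.log_exp, Real.log_div (by positivity) (by positivity), Real.log_pow] at h
  linarith

theorem abs_log_factorial_floor_sub_le {N d : ℕ} (hN : 1 ≤ N) (hd : 1 ≤ d) :
    |Real.log ((N / d).factorial : ℝ) - ((N / d : ℝ) * Real.log (N / d : ℝ) - (N / d : ℝ))| ≤
      1 + Real.log N := by
  have hN0 : (0 : ℝ) < N := by exact_mod_cast hN
  have hd0 : (1 : ℝ) ≤ d := by exact_mod_cast hd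
  have hyN : (N / d : ℝ) ≤ N := div_le_self hN0.le hd0
  have hlogN : 0 ≤ Real.log N := Real.log_nonneg (by exact_mod_cast hN)
  have hfl : ((N / d : ℕ) : ℝ) ≤ (N / d : ℝ) := Nat.cast_div_le
  have hfl' : (N / d : ℝ) ≤ ((N / d : ℕ) : ℝ) + 1 := by
    rw [← Nat.floor_div_eq_div (K := ℝ)]; exact (Nat.lt_floor_add_one _).le
  have hy0 : (0 : ℝ) < N / d := by positivity
  generalize (N / d : ℝ) = y at *
  generalize N / d = n at *
  have hlogy : Real.log y ≤ Real.log N := Real.log_le_log hy0 hyN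
  rw [abs_le]
  rcases n.eq_zero_or_pos with rfl | hn
  · have h1 := Real.one_sub_inv_le_log_of_pos hy0
    have h2 := mul_le_mul_of_nonneg_left h1 hy0.le
    have h3 : y * (1 - y⁻¹) = y - 1 := by field_simp
    have h4 : Real.log y ≤ 0 := Real.log_nonpos hy0.le (by simpa using hfl')
    have h5 := mul_nonpos_of_nonneg_of_nonpos hy0.le h4
    simp only [Nat.factorial_zero, Nat.cast_one, Real.log_one]
    constructor <;> linarith
  · have hn1 : (1 : ℝ) ≤ n := by exact_mod_cast hn
    constructor
    · have h1 := mul_log_sub_le_log_factorial (n + 1)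
      rw [Nat.factorial_succ, Nat.cast_mul, Real.log_mul (by positivity) (by positivity)] at h1
      push_cast at h1
      have h2 : Real.log y ≤ Real.log (n + 1) := Real.log_le_log hy0 hfl'
      have h3 : (y - 1) * Real.log y ≤ n * Real.log (n + 1) :=
        mul_le_mul (by linarith) h2 (Real.log_nonneg (by linarith)) (by linarith)
      linarith
    · have h1 := log_factorial_le n hn
      have h2 := mul_log_sub_self_mono hn1 hfl
      have h3 : Real.log n ≤ Real.log y := Real.log_le_log (by linarith) hfl
      linarith

/-- Pairs `(d, b)` such that `∑ b ⌊m / d⌋` is at least `4` for `1 ≤ m < 36` and nonnegative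
otherwise. -/
def chebyshevCoeffs : List (ℕ × ℤ) :=
  [(1, 4), (2, -4), (3, -4), (5, -4), (6, 4), (7, -4), (10, 4), (12, -4), (14, 2), (15, 2),
   (18, -4), (20, -2), (21, 2), (28, 2), (30, -6), (36, 4), (42, -6), (45, -2), (60, 6),
   (63, -2), (70, -2), (84, 2), (90, 8), (105, -4), (126, 4), (140, 2), (180, -6), (210, 8),
   (252, -5), (315, -1), (420, -3), (630, -2), (1260, -6)]

def floorSum (l : List (ℕ × ℤ)) (m : ℕ) : ℤ := (l.map fun p ↦ p.2 * ((m / p.1 : ℕ) : ℤ)).sum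

theorem sum_mul_log_factorial_eq (l : List (ℕ × ℤ)) (N : ℕ) :
    (l.map fun p ↦ (p.2 : ℝ) * Real.log ((N / p.1).factorial : ℝ)).sum =
      ∑ n ∈ Finset.Ioc 0 N, ArithmeticFunction.vonMangoldt n * (floorSum l (N / n) : ℝ) := by
  induction l with
  | nil => simp [floorSum]
  | cons p l ih =>
    rw [List.map_cons, List.sum_cons, ih, log_factorial_div_eq_sum_vonMangoldt, Finset.mul_sum,
      ← Finset.sum_add_distrib]
    refine Finset.sum_congr rfl fun n _ ↦ ?_
    simp only [floorSum, List.map_cons, List.sum_cons]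
    rw [Int.cast_add, Int.cast_mul, Int.cast_natCast]
    ring

theorem sum_mul_log_factorial_le {l : List (ℕ × ℤ)} (hl : ∀ p ∈ l, 1 ≤ p.1) {N : ℕ}
    (hN : 1 ≤ N) :
    (l.map fun p ↦ (p.2 : ℝ) * Real.log ((N / p.1).factorial : ℝ)).sum ≤
      N * (Real.log N - 1) * (l.map fun p ↦ (p.2 : ℝ) / p.1).sum
        - N * (l.map fun p ↦ (p.2 : ℝ) / p.1 * Real.log p.1).sum
        + (1 + Real.log N) * (l.map fun p ↦ |(p.2 : ℝ)|).sum := by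
  induction l with
  | nil => simp
  | cons p l ih =>
    obtain ⟨hp, hl⟩ := List.forall_mem_cons.1 hl
    have ih := ih hl
    have h := abs_log_factorial_floor_sub_le hN hp
    have h1 := (le_abs_self _).trans_eq (abs_mul (p.2 : ℝ) (Real.log ((N / p.1).factorial : ℝ) -
      ((N / p.1 : ℝ) * Real.log (N / p.1 : ℝ) - (N / p.1 : ℝ))))
    have h2 := mul_le_mul_of_nonneg_left h (abs_nonneg (p.2 : ℝ))
    have hN0 : (N : ℝ) ≠ 0 := by positivity
    have hp0 : (p.1 : ℝ) ≠ 0 := by positivity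
    rw [Real.log_div hN0 hp0] at h1 h2
    simp only [List.map_cons, List.sum_cons]
    have h3 : (p.2 : ℝ) * (Real.log ((N / p.1).factorial : ℝ) -
        ((N / p.1 : ℝ) * (Real.log N - Real.log p.1) - (N / p.1 : ℝ))) =
        (p.2 : ℝ) * Real.log ((N / p.1).factorial : ℝ) - (N * (Real.log N - 1) * ((p.2 : ℝ) / p.1)
          - N * ((p.2 : ℝ) / p.1 * Real.log p.1)) := by
      ring
    rw [h3] at h1
    linarith

theorem floorSum_chebyshevCoeffs_add_period (m q : ℕ) :
    floorSum chebyshevCoeffs (m + 1260 * q) = floorSum chebyshevCoeffs m := by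
  simp only [floorSum, chebyshevCoeffs, List.map_cons, List.sum_cons, List.map_nil, List.sum_nil]
  omega

theorem floorSum_chebyshevCoeffs_nonneg (m : ℕ) : 0 ≤ floorSum chebyshevCoeffs m := by
  have h : ∀ r < 1260, 0 ≤ floorSum chebyshevCoeffs r := by decide +kernel
  rw [← Nat.mod_add_div m 1260, floorSum_chebyshevCoeffs_add_period]
  exact h _ (Nat.mod_lt _ (by norm_num))

theorem four_le_floorSum_chebyshevCoeffs {m : ℕ} (h0 : 1 ≤ m) (h : m < 36) :
    4 ≤ floorSum chebyshevCoeffs m := by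
  have : ∀ r < 36, 1 ≤ r → 4 ≤ floorSum chebyshevCoeffs r := by decide +kernel
  exact this m h h0

theorem four_mul_psi_sub_le (N : ℕ) :
    4 * (Chebyshev.psi N - Chebyshev.psi (N / 36 : ℕ)) ≤
      (chebyshevCoeffs.map fun p ↦ (p.2 : ℝ) * Real.log ((N / p.1).factorial : ℝ)).sum := by
  rw [sum_mul_log_factorial_eq, Chebyshev.psi, Chebyshev.psi, Nat.floor_natCast, Nat.floor_natCast,
    ← Finset.sum_sdiff (Finset.Ioc_subset_Ioc_right (Nat.div_le_self N 36)), add_sub_cancel_right,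
    ← Finset.sum_sdiff (Finset.Ioc_subset_Ioc_right (Nat.div_le_self N 36)), Finset.mul_sum]
  refine le_add_of_le_of_nonneg (Finset.sum_le_sum fun n hn ↦ ?_)
    (Finset.sum_nonneg fun n _ ↦ mul_nonneg ArithmeticFunction.vonMangoldt_nonneg
      (by exact_mod_cast floorSum_chebyshevCoeffs_nonneg _))
  simp only [Finset.mem_sdiff, Finset.mem_Ioc, not_and, not_le] at hn
  have hn1 := hn.2 hn.1.1
  have h : 4 ≤ floorSum chebyshevCoeffs (N / n) := by
    refine four_le_floorSum_chebyshevCoeffs ((Nat.one_le_div_iff hn.1.1).2 hn.1.2) ?_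
    rw [Nat.div_lt_iff_lt_mul hn.1.1]
    rw [Nat.div_lt_iff_lt_mul (by norm_num)] at hn1
    linarith
  rw [mul_comm]
  exact mul_le_mul_of_nonneg_left (by exact_mod_cast h) ArithmeticFunction.vonMangoldt_nonneg

theorem log_seven_mem_Ioo : Real.log 7 ∈ Set.Ioo 1.9459101 1.9459102 := by
  have h : Real.log (2401 / 2400) =
      4 * Real.log 7 - (5 * Real.log 2 + Real.log 3 + 2 * Real.log 5) := by
    rw [show (2401 / 2400 : ℝ) = 7 ^ 4 / (2 ^ 5 * 3 * 5 ^ 2) by norm_num,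
      Real.log_div (by norm_num) (by norm_num), Real.log_mul (by norm_num) (by norm_num),
      Real.log_mul (by norm_num) (by norm_num), Real.log_pow, Real.log_pow, Real.log_pow]
    norm_num
  have h1 := Real.one_sub_inv_le_log_of_pos (show (0 : ℝ) < 2401 / 2400 by norm_num)
  have h2 := Real.log_le_sub_one_of_pos (show (0 : ℝ) < 2401 / 2400 by norm_num)
  rw [h] at h1 h2
  norm_num at h1 h2
  constructor <;> linarith [Real.log_two_gt_d9, Real.log_two_lt_d9, Real.log_three_gt_d9,
    Real.log_three_lt_d9, Real.log_five_gt_d9, Real.log_five_lt_d9]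

theorem neg_sum_chebyshevCoeffs_mul_log_le :
    -(chebyshevCoeffs.map fun p ↦ (p.2 : ℝ) / p.1 * Real.log p.1).sum ≤ 4.110549 := by
  have h (n a b c d : ℕ) (hn : n = 2 ^ a * 3 ^ b * 5 ^ c * 7 ^ d) : Real.log (n : ℝ) =
      a * Real.log 2 + b * Real.log 3 + c * Real.log 5 + d * Real.log 7 := by
    rw [hn]
    push_cast
    rw [Real.log_mul (by positivity) (by positivity), Real.log_mul (by positivity) (by positivity),
      Real.log_mul (by positivity) (by positivity), Real.log_pow, Real.log_pow, Real.log_pow,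
      Real.log_pow]
  simp only [chebyshevCoeffs, List.map_cons, List.map_nil, List.sum_cons, List.sum_nil,
    h 1 0 0 0 0 (by norm_num), h 2 1 0 0 0 (by norm_num), h 3 0 1 0 0 (by norm_num),
    h 5 0 0 1 0 (by norm_num), h 6 1 1 0 0 (by norm_num), h 7 0 0 0 1 (by norm_num),
    h 10 1 0 1 0 (by norm_num), h 12 2 1 0 0 (by norm_num), h 14 1 0 0 1 (by norm_num),
    h 15 0 1 1 0 (by norm_num), h 18 1 2 0 0 (by norm_num), h 20 2 0 1 0 (by norm_num),
    h 21 0 1 0 1 (by norm_num), h 28 2 0 0 1 (by norm_num), h 30 1 1 1 0 (by norm_num),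
    h 36 2 2 0 0 (by norm_num), h 42 1 1 0 1 (by norm_num), h 45 0 2 1 0 (by norm_num),
    h 60 2 1 1 0 (by norm_num), h 63 0 2 0 1 (by norm_num), h 70 1 0 1 1 (by norm_num),
    h 84 2 1 0 1 (by norm_num), h 90 1 2 1 0 (by norm_num), h 105 0 1 1 1 (by norm_num),
    h 126 1 2 0 1 (by norm_num), h 140 2 0 1 1 (by norm_num), h 180 2 2 1 0 (by norm_num),
    h 210 1 1 1 1 (by norm_num), h 252 2 2 0 1 (by norm_num), h 315 0 2 1 1 (by norm_num),
    h 420 2 1 1 1 (by norm_num), h 630 1 2 1 1 (by norm_num), h 1260 2 2 1 1 (by norm_num)]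
  push_cast
  obtain ⟨h7, h7'⟩ := log_seven_mem_Ioo
  linarith [Real.log_two_gt_d9, Real.log_two_lt_d9, Real.log_three_gt_d9,
    Real.log_three_lt_d9, Real.log_five_gt_d9, Real.log_five_lt_d9]

theorem psi_sub_psi_div_le {N : ℕ} (hN : 1 ≤ N) :
    Chebyshev.psi N - Chebyshev.psi (N / 36 : ℕ) ≤ 1.02763725 * N + 31.25 * (1 + Real.log N) := by
  have h := (four_mul_psi_sub_le N).trans
    (sum_mul_log_factorial_le (l := chebyshevCoeffs) (by decide) hN)
  have h0 : (chebyshevCoeffs.map fun p ↦ (p.2 : ℝ) / p.1).sum = 0 := by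
    norm_num [chebyshevCoeffs]
  have h1 : (chebyshevCoeffs.map fun p ↦ |(p.2 : ℝ)|).sum = 125 := by
    norm_num [chebyshevCoeffs]
  rw [h0, h1] at h
  have h2 := mul_le_mul_of_nonneg_left neg_sum_chebyshevCoeffs_mul_log_le (Nat.cast_nonneg (α := ℝ) N)
  linarith

theorem psi_natCast_le {N : ℕ} (hN : 1 ≤ N) :
    Chebyshev.psi N ≤ 1.057 * N + 4.4 * Real.log N ^ 2 + 25 * Real.log N + 34 := by
  induction N using Nat.strong_induction_on with
  | _ N ih =>
    have h := psi_sub_psi_div_le hN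
    have hN0 : (1 : ℝ) ≤ N := by exact_mod_cast hN
    have hlog : 0 ≤ Real.log N := Real.log_nonneg hN0
    rcases (N / 36).eq_zero_or_pos with h0 | h0
    · rw [h0, Nat.cast_zero, Chebyshev.psi_eq_zero_of_lt_two (x := 0) (by norm_num)] at h
      nlinarith [sq_nonneg (Real.log N - 0.7)]
    have h36 : Real.log 36 ∈ Set.Ioo 3.5835 3.5836 := by
      rw [show (36 : ℝ) = (2 * 3) ^ 2 by norm_num, Real.log_pow,
        Real.log_mul (by norm_num) (by norm_num)]
      push_cast
      constructor <;> linarith [Real.log_two_gt_d9, Real.log_two_lt_d9, Real.log_three_gt_d9,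
        Real.log_three_lt_d9]
    have h1 := ih (N / 36) (Nat.div_lt_self hN (by norm_num)) h0
    have hle : ((N / 36 : ℕ) : ℝ) ≤ N / 36 := Nat.cast_div_le
    have h0' : (1 : ℝ) ≤ (N / 36 : ℕ) := by exact_mod_cast h0
    have h2 : Real.log (N / 36 : ℕ) ≤ Real.log N - Real.log 36 := by
      rw [← Real.log_div (by linarith) (by norm_num)]
      exact Real.log_le_log (by linarith) hle
    have h3 := pow_le_pow_left₀ (Real.log_nonneg h0') h2 2
    obtain ⟨h4, h5⟩ := h36
    generalize Real.log (N / 36 : ℕ) = M at *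
    generalize Real.log N = L at *
    generalize Real.log 36 = l at *
    nlinarith [mul_le_mul_of_nonneg_left h4.le hlog, mul_self_nonneg (l - 3.5835)]

theorem nine_le_log {t : ℝ} (ht : 10000 ≤ t) : 9 ≤ Real.log t := by
  rw [Real.le_log_iff_exp_le (by linarith)]
  refine le_trans ?_ ht
  rw [← mul_one 9, ← Nat.cast_ofNat, Real.exp_nat_mul]
  exact (pow_le_pow_left₀ (Real.exp_pos 1).le Real.exp_one_lt_d9.le _).trans (by norm_num)

theorem theta_le_of_ten_thousand_le {t : ℝ} (ht : 10000 ≤ t) :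
    Chebyshev.theta t ≤ 1.058 * t + 900 := by
  have hfl : 1 ≤ ⌊t⌋₊ := Nat.le_floor (by norm_num; linarith)
  have hfl' : (⌊t⌋₊ : ℝ) ≤ t := Nat.floor_le (by linarith)
  have h := (Chebyshev.theta_le_psi t).trans
    ((Chebyshev.psi_eq_psi_coe_floor t).trans_le (psi_natCast_le hfl))
  have h1 : (1 : ℝ) ≤ ⌊t⌋₊ := by exact_mod_cast hfl
  have h2 : Real.log ⌊t⌋₊ ≤ Real.log t := Real.log_le_log (by linarith) hfl'
  have h0 : 0 ≤ Real.log ⌊t⌋₊ := Real.log_nonneg h1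
  have h3 := pow_le_pow_left₀ h0 h2 2
  have h9 := nine_le_log ht
  have h4 : 59000 * (1 + (Real.log t - 11) / 2) ^ 2 ≤ t := by
    have h5 := pow_le_pow_left₀ (by linarith) (Real.add_one_le_exp ((Real.log t - 11) / 2)) 2
    rw [← Real.exp_nat_mul, Nat.cast_ofNat, mul_div_cancel₀ _ (by norm_num), Real.exp_sub,
      Real.exp_log (by linarith)] at h5
    have h6 : 59000 ≤ Real.exp 11 := by
      rw [show (11 : ℝ) = (11 : ℕ) * 1 by norm_num, Real.exp_nat_mul]
      refine le_trans ?_ (pow_le_pow_left₀ (by norm_num) Real.exp_one_gt_d9.le _)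
      norm_num
    have h7 := (le_div_iff₀ (Real.exp_pos 11)).1 h5
    refine le_trans ?_ h7
    rw [mul_comm, add_comm]
    gcongr
  nlinarith [sq_nonneg (Real.log t - 14)]

theorem hasDerivAt_id_div_log_sq {t : ℝ} (ht : 1 < t) :
    HasDerivAt (fun t ↦ 1.058 * (t / Real.log t ^ 2 + 3 * t / Real.log t ^ 3) - 900 / Real.log t)
      (1.058 * (1 / Real.log t ^ 2 + 1 / Real.log t ^ 3 - 9 / Real.log t ^ 4)
        + 900 / (t * Real.log t ^ 2)) t := by
  have hL : 0 < Real.log t := Real.log_pos ht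
  have hl := Real.hasDerivAt_log (show t ≠ 0 by linarith)
  have h1 := (hasDerivAt_id t).div (hl.pow 2) (pow_pos hL 2).ne'
  have h2 := ((hasDerivAt_id t).const_mul 3).div (hl.pow 3) (pow_pos hL 3).ne'
  have h3 := (hasDerivAt_const t (900 : ℝ)).div hl hL.ne'
  convert! ((h1.add h2).const_mul 1.058).sub h3 using 1
  have ht0 : t ≠ 0 := by linarith
  simp only [id, Nat.cast_ofNat, Pi.pow_apply]
  field_simp
  ring

theorem integral_theta_div_le {x : ℝ} (hx : 10000 ≤ x) :
    ∫ t in (10000 : ℝ)..x, Chebyshev.theta t / (t * Real.log t ^ 2) ≤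
      1.058 * (x / Real.log x ^ 2 + 3 * x / Real.log x ^ 3) - 900 / Real.log x
        + 900 / Real.log 10000 := by
  have h := intervalIntegral.integral_le_sub_of_hasDeriv_right_of_le hx
    (fun t ht ↦ (hasDerivAt_id_div_log_sq (by linarith [ht.1])).continuousAt.continuousWithinAt)
    (fun t ht ↦ (hasDerivAt_id_div_log_sq (by linarith [ht.1])).hasDerivWithinAt)
    ((Chebyshev.integrableOn_theta_div_id_mul_log_sq x).mono_set
      (Set.Icc_subset_Icc_left (by norm_num)))
    fun t ht ↦ ?_
  · refine h.trans ?_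
    have h1 : 0 < Real.log 10000 := Real.log_pos (by norm_num)
    have h2 : 0 ≤ 10000 / Real.log 10000 ^ 2 + 3 * 10000 / Real.log 10000 ^ 3 := by positivity
    linarith
  · have ht' : 10000 ≤ t := ht.1.le
    have hL := nine_le_log ht'
    have h1 : 0 ≤ 1 / Real.log t ^ 3 - 9 / Real.log t ^ 4 := by
      rw [show 1 / Real.log t ^ 3 - 9 / Real.log t ^ 4 = (Real.log t - 9) / Real.log t ^ 4 by
        field_simp]
      exact div_nonneg (by linarith) (by positivity)
    have h2 : Chebyshev.theta t / (t * Real.log t ^ 2) ≤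
        (1.058 * t + 900) / (t * Real.log t ^ 2) := by
      gcongr
      exact theta_le_of_ten_thousand_le ht'
    have h3 : (1.058 * t + 900) / (t * Real.log t ^ 2) =
        1.058 * (1 / Real.log t ^ 2) + 900 / (t * Real.log t ^ 2) := by
      field_simp
    linarith

theorem primeCounting_le_of_ten_thousand_le {x : ℝ} (hx : 10000 ≤ x) :
    (Nat.primeCounting ⌊x⌋₊ : ℝ) ≤
      1.058 * x / Real.log x * (1 + 1 / Real.log x + 3 / Real.log x ^ 2) + 1330 := by
  have h1 := Chebyshev.primeCounting_eq_theta_div_log_add_integral (show 2 ≤ x by linarith)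
  have h2 := Chebyshev.primeCounting_eq_theta_div_log_add_integral (show 2 ≤ (10000 : ℝ) by norm_num)
  have hint (y : ℝ) (hy : 2 ≤ y) := (intervalIntegrable_iff_integrableOn_Icc_of_le hy).2
    (Chebyshev.integrableOn_theta_div_id_mul_log_sq y)
  have h3 := intervalIntegral.integral_add_adjacent_intervals (hint 10000 (by norm_num))
    ((hint 10000 (by norm_num)).symm.trans (hint x (by linarith)))
  have h4 := integral_theta_div_le hx
  have h5 : (Nat.primeCounting ⌊(10000 : ℝ)⌋₊ : ℝ) ≤ 1230 := by
    have h (n : ℕ) : Nat.primeCounting n ≤ Nat.primeCounting' n + 1 := by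
      rw [Nat.primeCounting, Nat.primeCounting', Nat.count_succ]
      split_ifs <;> simp
    have h1 : (Nat.primeCounting 10000 : ℝ) ≤ Nat.primeCounting' 10000 + 1 := by
      exact_mod_cast h 10000
    have h2 : (Nat.primeCounting' 10000 : ℝ) ≤ 1229 := by
      exact_mod_cast primeCounting'_ten_thousand_le
    rw [Nat.floor_ofNat]
    linarith
  have h6 : 0 ≤ Chebyshev.theta 10000 / Real.log 10000 :=
    div_nonneg (Chebyshev.theta_nonneg _) (Real.log_nonneg (by norm_num))
  have h7 : 900 / Real.log 10000 ≤ 100 := by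
    rw [show (10000 : ℝ) = (2 * 5) ^ 4 by norm_num, Real.log_pow,
      Real.log_mul (by norm_num) (by norm_num)]
    have := Real.log_two_gt_d9
    have := Real.log_five_gt_d9
    push_cast
    rw [div_le_iff₀ (by linarith)]
    linarith
  have hL : 0 < Real.log x := Real.log_pos (by linarith)
  have h8 : Chebyshev.theta x / Real.log x ≤ (1.058 * x + 900) / Real.log x := by
    gcongr
    exact theta_le_of_ten_thousand_le hx
  have h9 : 1.058 * x / Real.log x * (1 + 1 / Real.log x + 3 / Real.log x ^ 2) =
      (1.058 * x + 900) / Real.log x +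
        (1.058 * (x / Real.log x ^ 2 + 3 * x / Real.log x ^ 3) - 900 / Real.log x) := by
    field_simp
    ring
  rw [h9, h1, ← h3]
  rw [h2] at h5
  linarith only [h4, h5, h6, h7, h8]

theorem primeCounting_lt_of_twelve_million_le {x : ℝ} (hx : 12000000 ≤ x) :
    (Nat.primeCounting ⌊x⌋₊ : ℝ) < 1.139 * x / Real.log x := by
  have hlog : Real.log 12000000 ∈ Set.Ioo 16.3 16.31 := by
    rw [show (12000000 : ℝ) = 2 ^ 8 * 3 * 5 ^ 6 by norm_num, Real.log_mul (by norm_num)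
      (by norm_num), Real.log_mul (by norm_num) (by norm_num), Real.log_pow, Real.log_pow]
    push_cast
    constructor <;> linarith [Real.log_two_gt_d9, Real.log_two_lt_d9, Real.log_three_gt_d9,
        Real.log_three_lt_d9, Real.log_five_gt_d9, Real.log_five_lt_d9]
  have hL : 16.3 ≤ Real.log x := hlog.1.le.trans (Real.log_le_log (by norm_num) hx)
  have hL0 : 0 < Real.log x := by linarith
  have hx0 : 0 < x := by linarith
  have hanti : Real.log x / x ≤ Real.log 12000000 / 12000000 := by
    have := Real.exp_one_lt_d9
    exact Real.log_div_self_antitoneOn (show Real.exp 1 ≤ 12000000 by linarith)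
      (show Real.exp 1 ≤ x by linarith) hx
  have h1 : 1 / Real.log x ≤ 1 / 16.3 := by gcongr
  have h2 : 3 / Real.log x ^ 2 ≤ 3 / 16.3 ^ 2 := by gcongr
  have h3 : 1.058 * (1 + 1 / Real.log x + 3 / Real.log x ^ 2) + 1330 * (Real.log x / x) < 1.139 := by
    have h4 := hlog.2
    norm_num at h1 h2 h4 hanti ⊢
    linarith
  refine (primeCounting_le_of_ten_thousand_le (by linarith)).trans_lt ?_
  have h4 := mul_lt_mul_of_pos_left h3 (div_pos hx0 hL0)
  convert! h4 using 1
  · field_simp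
  · ring

theorem primeCounting_upper_bound (x : ℝ) (hx : x > 10000) :
    (Nat.primeCounting ⌊x⌋₊ : ℝ) < 1.139 * x / Real.log x := by
  rcases lt_or_ge x 12000000 with h | h
  · exact primeCounting_lt_of_lt_twelve_million hx.le h
  · exact primeCounting_lt_of_twelve_million_le h
end
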